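/- arXiv:2510.17623 — 6 statements merged into one kernel-verified Lean document; each statement's English description precedes it below -/
import Mathlib

section
/- Let λ > 0 and let 0 < r_1 < r_2 < r_3 be real numbers, set r_0 = −(r_1 + r_2 + r_3), and define Δ(r) = −λ(r − r_0)(r − r_1)(r − r_2)(r − r_3) with derivative Δ'. Then for every r with r_2 < r < r_3 one has P(r) := 4 r Δ(r) − (r² − r_2²) Δ'(r) > 0. -/
/-- A quadratic `A r² + (A b - 3 q) r + q b` with `0 < q < A b` has no nonnegative roots. -/
lemma quadratic_pos_of_lt_mul {A b q r : ℝ} (hA : 0 < A) (hb : 0 < b) (hq : 0 < q)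
    (hAq : q < A * b) (hr : 0 ≤ r) : 0 < A * r ^ 2 + (A * b - 3 * q) * r + q * b := by
  rcases le_total (3 * q) (A * b) with h | h
  · have := mul_nonneg (sub_nonneg.2 h) hr
    positivity
  · have hdisc : 0 < (A * b - q) * (9 * q - A * b) :=
      mul_pos (by linarith) (by linarith)
    have hsq : 4 * A * (A * r ^ 2 + (A * b - 3 * q) * r + q * b) =
        (2 * A * r + (A * b - 3 * q)) ^ 2 + (A * b - q) * (9 * q - A * b) := by ring
    refine (mul_pos_iff_of_pos_left (show 0 < 4 * A by positivity)).1 ?_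
    rw [hsq]
    positivity


/-- For `λ > 0`, `0 < r₁ < r₂ < r₃`, `r₀ = -(r₁+r₂+r₃)`, and
`Δ(r) = -λ(r-r₀)(r-r₁)(r-r₂)(r-r₃)`, the quantity
`P(r) = 4rΔ(r) - (r² - r₂²)Δ'(r)` is strictly positive on `(r₂, r₃)`. -/
theorem stmt_0 (lam r₁ r₂ r₃ : ℝ) (hlam : 0 < lam)
    (h₁ : 0 < r₁) (h₁₂ : r₁ < r₂) (h₂₃ : r₂ < r₃)
    (r₀ : ℝ) (hr₀ : r₀ = -(r₁ + r₂ + r₃))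
    (Δ : ℝ → ℝ)
    (hΔ : ∀ r, Δ r = -lam * (r - r₀) * (r - r₁) * (r - r₂) * (r - r₃)) :
    ∀ r, r₂ < r → r < r₃ →
      0 < 4 * r * Δ r - (r ^ 2 - r₂ ^ 2) * deriv Δ r := by
  intro r hr _
  subst hr₀
  have h₂ : 0 < r₂ := h₁.trans h₁₂
  have h₃ : 0 < r₃ := h₂.trans h₂₃
  have hr_pos : 0 < r := h₂.trans hr
  set A := 2 * (r₁ ^ 2 + r₃ ^ 2 - r₂ ^ 2 + r₁ * r₂ + r₂ * r₃ + r₃ * r₁) with hA_def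
  set q := (r₁ + r₂) * (r₂ + r₃) * (r₃ + r₁) with hq_def
  have hA : 0 < A := by
    have h_diff : 0 < r₃ ^ 2 - r₂ ^ 2 := by nlinarith
    have h_rest : 0 < r₁ ^ 2 + r₁ * r₂ + r₂ * r₃ + r₃ * r₁ := by positivity
    linarith
  have hq : 0 < q := by positivity
  have hAq : q < A * r₂ := by
    have h_pos : 0 < (2 * r₂ + r₁ + r₃) * (r₂ - r₁) * (r₃ - r₂) :=
      mul_pos (mul_pos (by positivity) (sub_pos.2 h₁₂)) (sub_pos.2 h₂₃)
    have h_eq : A * r₂ - q = (2 * r₂ + r₁ + r₃) * (r₂ - r₁) * (r₃ - r₂) := by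
      rw [hA_def, hq_def]; ring
    linarith
  have hderiv := (((((hasDerivAt_id' r).sub_const (-(r₁ + r₂ + r₃))).const_mul (-lam)).fun_mul
    ((hasDerivAt_id' r).sub_const r₁)).fun_mul ((hasDerivAt_id' r).sub_const r₂)).fun_mul
    ((hasDerivAt_id' r).sub_const r₃)
  have hfactor : 4 * r * Δ r - (r ^ 2 - r₂ ^ 2) * deriv Δ r =
      lam * (r - r₂) * (A * r ^ 2 + (A * r₂ - 3 * q) * r + q * r₂) := by
    rw [hΔ, funext hΔ, hderiv.deriv, hA_def, hq_def]
    ring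
  rw [hfactor]
  exact mul_pos (mul_pos hlam (sub_pos.2 hr))
    (quadratic_pos_of_lt_mul hA h₂ hq hAq hr_pos.le)
end

section
/- Let λ ≥ 0 and let a, r, θ, k_t, k_φ be real numbers with r > 0, Δ_r(r) > 0, a k_φ < 0, and 0 < k_t ≤ (μ(r,θ)/σ²(r,θ)) · (−a k_φ). Then k_t < (−a k_φ)/(r² + a²), and consequently k_t ((r² + a²) k_t + a k_φ) < 0. -/
/-- If `λ ≥ 0`, `r > 0`, `Δ_r(r) > 0`, `a k_φ < 0` and
`0 < k_t ≤ (μ/σ²)(-a k_φ)`, then `k_t < (-a k_φ)/(r²+a²)` and hence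
`k_t((r²+a²)k_t + a k_φ) < 0`. -/
theorem stmt_3 (lam a r θ kt kφ : ℝ) (hlam : 0 ≤ lam) (hr : 0 < r)
    (Δr Δθ μ σ2 : ℝ)
    (hΔr : Δr = (1 - lam * r ^ 2) * (r ^ 2 + a ^ 2) - 2 * r)
    (hΔθ : Δθ = 1 + lam * a ^ 2 * Real.cos θ ^ 2)
    (hμ : μ = (r ^ 2 + a ^ 2) * Δθ - Δr)
    (hσ2 : σ2 = (r ^ 2 + a ^ 2) ^ 2 * Δθ - a ^ 2 * Real.sin θ ^ 2 * Δr)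
    (hΔpos : 0 < Δr)
    (hakφ : a * kφ < 0)
    (hktpos : 0 < kt) (hktle : kt ≤ μ / σ2 * (-(a * kφ))) :
    kt < -(a * kφ) / (r ^ 2 + a ^ 2) ∧
      kt * ((r ^ 2 + a ^ 2) * kt + a * kφ) < 0 := by
  have hsc : Real.sin θ ^ 2 = 1 - Real.cos θ ^ 2 := Real.sin_sq θ
  have hR : 0 < r ^ 2 + a ^ 2 := by positivity
  have hρ : 0 < r ^ 2 + a ^ 2 * Real.cos θ ^ 2 := by positivity
  have hσpos : 0 < σ2 := by
    have h : σ2 = (1 + lam * a ^ 2) * (r ^ 2 + a ^ 2) * (r ^ 2 + a ^ 2 * Real.cos θ ^ 2)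
        + 2 * r * a ^ 2 * Real.sin θ ^ 2 := by
      rw [hσ2, hΔθ, hΔr, hsc]
      ring
    rw [h]
    positivity
  have hgap : μ / σ2 < 1 / (r ^ 2 + a ^ 2) := by
    rw [div_lt_div_iff₀ hσpos hR]
    have h : 1 * σ2 - μ * (r ^ 2 + a ^ 2) = Δr * (r ^ 2 + a ^ 2 * Real.cos θ ^ 2) := by
      rw [hσ2, hμ, hsc]
      ring
    linarith [mul_pos hΔpos hρ]
  have hkt : kt < -(a * kφ) / (r ^ 2 + a ^ 2) := by
    calc kt ≤ μ / σ2 * (-(a * kφ)) := hktle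
      _ < 1 / (r ^ 2 + a ^ 2) * (-(a * kφ)) :=
        mul_lt_mul_of_pos_right hgap (neg_pos.mpr hakφ)
      _ = -(a * kφ) / (r ^ 2 + a ^ 2) := by ring
  refine ⟨hkt, mul_neg_of_pos_of_neg hktpos ?_⟩
  rw [lt_div_iff₀ hR] at hkt
  linarith
end

section
/- Let 0 < r_− < r_+ be real numbers and define Δ(r) = (r − r_−)(r − r_+) with derivative Δ'. Set P(r) = 4 r Δ(r) − (r² − r_+²) Δ'(r). Then P(r_+) = 0, P is strictly increasing on [r_+, ∞), and consequently P(r) > 0 for every r > r_+. -/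
/-- For Kerr (`λ = 0`), with `Δ(r) = (r - r₋)(r - r₊)` and
`P(r) = 4rΔ(r) - (r² - r₊²)Δ'(r)`, one has `P(r₊) = 0`, `P` is strictly
increasing on `[r₊, ∞)`, and consequently `P(r) > 0` for all `r > r₊`. -/
theorem stmt_5 (rm rp : ℝ) (h0 : 0 < rm) (hmp : rm < rp)
    (Δ P : ℝ → ℝ)
    (hΔ : ∀ r, Δ r = (r - rm) * (r - rp))
    (hP : ∀ r, P r = 4 * r * Δ r - (r ^ 2 - rp ^ 2) * deriv Δ r) :
    P rp = 0 ∧ StrictMonoOn P (Set.Ici rp) ∧ ∀ r, rp < r → 0 < P r := by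
  have hderiv (r : ℝ) : deriv Δ r = (r - rp) + (r - rm) := by
    have h : HasDerivAt Δ (1 * (r - rp) + (r - rm) * 1) r := by
      rw [show Δ = fun r ↦ (r - rm) * (r - rp) from funext hΔ]
      exact ((hasDerivAt_id' r).sub_const rm).mul ((hasDerivAt_id' r).sub_const rp)
    rw [h.deriv]
    ring
  have hexp (r : ℝ) : P r = 2 * (r - rp) ^ 3 + 3 * (rp - rm) * (r - rp) ^ 2
      + 2 * rp * (rp - rm) * (r - rp) := by
    rw [hP, hΔ, hderiv]
    ring
  have hzero : P rp = 0 := by simp [hexp]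
  have hmono : StrictMonoOn P (Set.Ici rp) := by
    intro x hx y _ hxy
    have hx' : 0 ≤ x - rp := sub_nonneg.2 hx
    have hd : 0 < rp - rm := sub_pos.2 hmp
    have hrp : 0 < rp := h0.trans hmp
    rw [hexp, hexp]
    gcongr
  exact ⟨hzero, hmono, fun r hr ↦ hzero ▸ hmono Set.self_mem_Ici hr.le hr⟩
end

section
/- Let λ ≥ 0 and let a, r, θ, k_t, k_r, k_θ, k_φ be real numbers with r > 0, Δ_r(r) > 0 and sin θ ≠ 0. Define G = −(χ² σ²/(Δ_θ Δ_r)) k_t² − (2 a χ² μ/(Δ_θ Δ_r)) k_t k_φ + (χ² (Δ_r − a² sin²θ Δ_θ)/(sin²θ Δ_θ Δ_r)) k_φ² + Δ_r k_r² + Δ_θ k_θ². Then G = 0 if and only if k_t = −(μ/σ²) a k_φ + √D or k_t = −(μ/σ²) a k_φ − √D, where D = (Δ_r Δ_θ/σ²) · [ ρ⁴ k_φ²/(σ² sin²θ) + Δ_θ k_θ²/χ² + Δ_r k_r²/χ² ]. -/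
/-- The identity behind the discriminant of the null condition, as a quadratic in `k_t`, for
`R = r² + a²`, `s = sin² θ`, `A = a²`. -/
theorem kerr_discriminant_identity (R A s x y : ℝ) :
    A * s * (R * y - x) ^ 2 + (R ^ 2 * y - A * s * x) * (x - A * s * y) =
      x * y * (R - A * s) ^ 2 := by
  ring

/-- The null condition `G = 0` for the covector
`k = (k_t, k_r, k_θ, k_φ)` on the exterior block holds iff
`k_t = -(μ/σ²) a k_φ ± √D`. -/
theorem stmt_9 (lam a r θ kt kr kθ kφ : ℝ) (hlam : 0 ≤ lam) (hr : 0 < r)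
    (hsin : Real.sin θ ≠ 0)
    (Δr Δθ χ ρ2 μ σ2 G D : ℝ)
    (hΔr : Δr = (1 - lam * r ^ 2) * (r ^ 2 + a ^ 2) - 2 * r)
    (hΔθ : Δθ = 1 + lam * a ^ 2 * Real.cos θ ^ 2)
    (hχ : χ = 1 + lam * a ^ 2)
    (hρ2 : ρ2 = r ^ 2 + a ^ 2 * Real.cos θ ^ 2)
    (hμ : μ = (r ^ 2 + a ^ 2) * Δθ - Δr)
    (hσ2 : σ2 = (r ^ 2 + a ^ 2) ^ 2 * Δθ - a ^ 2 * Real.sin θ ^ 2 * Δr)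
    (hΔpos : 0 < Δr)
    (hG : G = -(χ ^ 2 * σ2 / (Δθ * Δr)) * kt ^ 2 -
        2 * a * χ ^ 2 * μ / (Δθ * Δr) * (kt * kφ) +
        χ ^ 2 * (Δr - a ^ 2 * Real.sin θ ^ 2 * Δθ) /
          (Real.sin θ ^ 2 * Δθ * Δr) * kφ ^ 2 +
        Δr * kr ^ 2 + Δθ * kθ ^ 2)
    (hD : D = Δr * Δθ / σ2 *
      (ρ2 ^ 2 * kφ ^ 2 / (σ2 * Real.sin θ ^ 2) + Δθ * kθ ^ 2 / χ ^ 2 +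
        Δr * kr ^ 2 / χ ^ 2)) :
    G = 0 ↔
      kt = -(μ / σ2) * (a * kφ) + Real.sqrt D ∨
        kt = -(μ / σ2) * (a * kφ) - Real.sqrt D := by
  have hχpos : 0 < χ := by rw [hχ]; positivity
  have hΔθ1 : 1 ≤ Δθ := by
    have : 0 ≤ lam * a ^ 2 * Real.cos θ ^ 2 := by positivity
    linarith
  have hΔθpos : 0 < Δθ := by linarith
  have hσpos : 0 < σ2 := by
    have hΔlt : Δr < r ^ 2 + a ^ 2 := by
      have : 0 ≤ lam * r ^ 2 * (r ^ 2 + a ^ 2) := by positivity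
      nlinarith
    have h1 : a ^ 2 * Real.sin θ ^ 2 * Δr ≤ a ^ 2 * 1 * (r ^ 2 + a ^ 2) := by
      gcongr
      exact Real.sin_sq_le_one θ
    have h2 : (r ^ 2 + a ^ 2) ^ 2 * 1 ≤ (r ^ 2 + a ^ 2) ^ 2 * Δθ := by gcongr
    have h3 : 0 < r ^ 2 * (r ^ 2 + a ^ 2) := by positivity
    rw [hσ2]
    nlinarith
  have hDnonneg : 0 ≤ D := by rw [hD]; positivity
  have hdisc : a ^ 2 * Real.sin θ ^ 2 * μ ^ 2 + σ2 * (Δr - a ^ 2 * Real.sin θ ^ 2 * Δθ) =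
      Δr * Δθ * ρ2 ^ 2 := by
    have hρ : ρ2 = r ^ 2 + a ^ 2 - a ^ 2 * Real.sin θ ^ 2 := by
      rw [hρ2, Real.cos_sq']; ring
    rw [hμ, hσ2, hρ]
    exact kerr_discriminant_identity _ _ _ _ _
  have hfactor : G = -(χ ^ 2 * σ2 / (Δθ * Δr)) * ((kt + μ / σ2 * (a * kφ)) ^ 2 - D) := by
    rw [hG, hD]
    clear hG hD hDnonneg hσ2 hμ hρ2 hχ hΔθ hΔr
    field_simp
    linear_combination χ ^ 2 * kφ ^ 2 * hdisc
  have hcoef : -(χ ^ 2 * σ2 / (Δθ * Δr)) ≠ 0 := neg_ne_zero.mpr (by positivity)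
  rw [hfactor, mul_eq_zero, or_iff_right hcoef, sub_eq_zero, ← Real.sq_sqrt hDnonneg,
    sq_eq_sq_iff_eq_or_eq_neg, Real.sq_sqrt hDnonneg]
  constructor <;> rintro (h | h)
  · left; linarith
  · right; linarith
  · left; linarith
  · right; linarith
end

section
/- Let λ ≥ 0 and a ≠ 0 be real with λ a² ≤ 1, let r > 0 satisfy Δ_r(r) > 0, let 0 < θ < π, and let k_θ, k_φ be real numbers, not both zero. Suppose the null condition for a covector with k_t = k_r = 0 holds: χ² (Δ_r(r) − a² sin²θ Δ_θ(θ)) k_φ² / (sin²θ Δ_θ(θ) Δ_r(r)) + Δ_θ(θ) k_θ² = 0. Then k_φ ≠ 0 and Δ_r(r) ≤ a² sin²θ Δ_θ(θ) ≤ a². Moreover, if additionally a k_φ Δ_r'(r) = 0 (the trapping condition ∂_r G_r = 0 specialized to k_t = 0), then Δ_r'(r) = 0. -/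
/-- The angular factor `sin²θ (1 + L cos²θ)` is at most `1` when `0 ≤ L ≤ 1`. -/
lemma sin_sq_mul_one_add_mul_cos_sq_le_one {L : ℝ} (hL0 : 0 ≤ L) (hL1 : L ≤ 1) (θ : ℝ) :
    Real.sin θ ^ 2 * (1 + L * Real.cos θ ^ 2) ≤ 1 := by
  rw [Real.sin_sq]
  nlinarith [mul_nonneg (sub_nonneg.2 hL1) (sq_nonneg (Real.cos θ)),
    mul_nonneg hL0 (sq_nonneg (Real.cos θ ^ 2))]

/-- A null covector with `k_t = k_r = 0` (and `(k_θ, k_φ) ≠ 0`)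
in the trapped region forces `k_φ ≠ 0` and
`Δ_r(r) ≤ a² sin²θ Δ_θ(θ) ≤ a²`; if moreover the trapping condition
`a k_φ Δ_r'(r) = 0` holds, then `Δ_r'(r) = 0`. -/
theorem stmt_12 (lam a θ kθ kφ : ℝ) (hlam : 0 ≤ lam) (ha : a ≠ 0)
    (hla : lam * a ^ 2 ≤ 1)
    (Δr : ℝ → ℝ)
    (hΔr : ∀ x, Δr x = (1 - lam * x ^ 2) * (x ^ 2 + a ^ 2) - 2 * x)
    (r : ℝ) (hr : 0 < r) (hΔpos : 0 < Δr r)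
    (hθ0 : 0 < θ) (hθπ : θ < Real.pi)
    (hk : ¬(kθ = 0 ∧ kφ = 0))
    (Δθ χ : ℝ)
    (hΔθ : Δθ = 1 + lam * a ^ 2 * Real.cos θ ^ 2)
    (hχ : χ = 1 + lam * a ^ 2)
    (hnull : χ ^ 2 * (Δr r - a ^ 2 * Real.sin θ ^ 2 * Δθ) * kφ ^ 2 /
        (Real.sin θ ^ 2 * Δθ * Δr r) + Δθ * kθ ^ 2 = 0) :
    (kφ ≠ 0 ∧ Δr r ≤ a ^ 2 * Real.sin θ ^ 2 * Δθ ∧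
      a ^ 2 * Real.sin θ ^ 2 * Δθ ≤ a ^ 2) ∧
    (a * kφ * deriv Δr r = 0 → deriv Δr r = 0) := by
  have hL : 0 ≤ lam * a ^ 2 := by positivity
  have hΔθpos : 0 < Δθ := by rw [hΔθ]; positivity
  have hχpos : 0 < χ := by rw [hχ]; positivity
  have hsin : 0 < Real.sin θ := Real.sin_pos_of_pos_of_lt_pi hθ0 hθπ
  have hkφ : kφ ≠ 0 := by
    rintro rfl
    refine hk ⟨?_, rfl⟩
    simpa [hΔθpos.ne'] using hnull
  refine ⟨⟨hkφ, ?_, ?_⟩, fun h => ?_⟩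
  · by_contra! hlt
    have hdiff : 0 < Δr r - a ^ 2 * Real.sin θ ^ 2 * Δθ := sub_pos.2 hlt
    have hφ : 0 < χ ^ 2 * (Δr r - a ^ 2 * Real.sin θ ^ 2 * Δθ) * kφ ^ 2 /
        (Real.sin θ ^ 2 * Δθ * Δr r) := by positivity
    have hθ : 0 ≤ Δθ * kθ ^ 2 := by positivity
    linarith
  · rw [hΔθ, mul_assoc]
    exact mul_le_of_le_one_right (sq_nonneg a)
      (sin_sq_mul_one_add_mul_cos_sq_le_one hL hla θ)
  · exact (mul_eq_zero.1 h).resolve_left (mul_ne_zero ha hkφ)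
end

section
/- For all smooth compactly supported functions f, h : ℝ → ℂ, the limit as ε → 0⁺ of −(1/π) ∫_ℝ ∫_ℝ conj(f(x)) h(y) (x − y − iε)^{−2} dx dy exists and equals 2 ∫_0^∞ η conj(f̂(η)) ĥ(η) dη, where ĥ(η) = (2π)^{−1/2} ∫_ℝ e^{iηx} h(x) dx. In particular, taking f = h, the limit is real and nonnegative. -/
open MeasureTheory Filter

/-- The Laplace transform of the identity. -/
lemma integral_mul_exp_neg_mul_Ioi {z : ℂ} (hz : 0 < z.re) :
    ∫ η in Set.Ioi (0 : ℝ), (η : ℂ) * Complex.exp (-(z * η)) = z ^ (-2 : ℤ) := by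
  have hz0 : z ≠ 0 := fun h => by simp [h] at hz
  have hnorm (η : ℝ) : ‖Complex.exp (-(z * η))‖ = Real.exp (-z.re * η) := by
    rw [Complex.norm_exp]; simp
  have hexp : Tendsto (fun η : ℝ => Complex.exp (-(z * η))) atTop (nhds 0) := by
    rw [tendsto_zero_iff_norm_tendsto_zero]
    simpa [hnorm] using tendsto_rpow_mul_exp_neg_mul_atTop_nhds_zero 0 z.re hz
  have hmul : Tendsto (fun η : ℝ => (η : ℂ) * Complex.exp (-(z * η))) atTop (nhds 0) := by
    rw [tendsto_zero_iff_norm_tendsto_zero]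
    refine (tendsto_rpow_mul_exp_neg_mul_atTop_nhds_zero 1 z.re hz).congr' ?_
    filter_upwards [eventually_ge_atTop 0] with η hη
    rw [norm_mul, hnorm, Complex.norm_real, Real.norm_of_nonneg hη, Real.rpow_one]
  have hderiv (η : ℝ) : HasDerivAt
      (fun η : ℝ => -(z⁻¹ * ((η : ℂ) * Complex.exp (-(z * η))) +
        z⁻¹ ^ 2 * Complex.exp (-(z * η))))
      ((η : ℂ) * Complex.exp (-(z * η))) η := by
    have hid : HasDerivAt (fun η : ℝ => (η : ℂ)) 1 η := (hasDerivAt_id η).ofReal_comp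
    have he := (hid.const_mul z).neg.cexp
    refine ((((hid.mul he).const_mul z⁻¹).add (he.const_mul (z⁻¹ ^ 2))).neg).congr_deriv ?_
    simp only [Pi.neg_apply]
    field_simp
    ring
  have hint : IntegrableOn (fun η : ℝ => (η : ℂ) * Complex.exp (-(z * η))) (Set.Ioi 0) := by
    refine (integrableOn_rpow_mul_exp_neg_mul_rpow (p := 1) (s := 1) (by norm_num)
      one_pos hz).mono' (Continuous.aestronglyMeasurable (by fun_prop)) ?_
    filter_upwards [ae_restrict_mem measurableSet_Ioi] with η hη
    rw [norm_mul, hnorm, Complex.norm_real, Real.norm_of_nonneg (le_of_lt hη), Real.rpow_one]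
  rw [integral_Ioi_of_hasDerivAt_of_tendsto' (fun η _ => hderiv η) hint
    ((hmul.const_mul z⁻¹).add (hexp.const_mul (z⁻¹ ^ 2))).neg]
  simp [zpow_neg, zpow_ofNat]

/-- The unnormalised Fourier integral with kernel `exp (i η x)`. -/
noncomputable def expIntegral (g : ℝ → ℂ) (η : ℝ) : ℂ :=
  ∫ x : ℝ, Complex.exp (Complex.I * η * x) * g x

lemma norm_exp_I_mul_mul (η x : ℝ) : ‖Complex.exp (Complex.I * η * x)‖ = 1 := by
  rw [Complex.norm_exp]; simp

lemma norm_expIntegral_le (g : ℝ → ℂ) (η : ℝ) : ‖expIntegral g η‖ ≤ ∫ x, ‖g x‖ := by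
  refine (norm_integral_le_integral_norm _).trans_eq ?_
  simp only [norm_mul, norm_exp_I_mul_mul, one_mul]

lemma continuous_expIntegral {g : ℝ → ℂ} (hg : Integrable g) : Continuous (expIntegral g) := by
  refine continuous_of_dominated (bound := fun x => ‖g x‖) (fun η => ?_) (fun η => ?_) hg.norm ?_
  · exact (Continuous.aestronglyMeasurable (by fun_prop)).mul hg.aestronglyMeasurable
  · exact Eventually.of_forall fun x => by rw [norm_mul, norm_exp_I_mul_mul, one_mul]
  · exact Eventually.of_forall fun x => by fun_prop

lemma integrable_mul_expIntegral {h : ℝ → ℂ}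
    (hh : ContDiff ℝ (⊤ : ℕ∞) h) (hhc : HasCompactSupport h) :
    Integrable fun η : ℝ => (η : ℂ) * expIntegral h η := by
  have hc : -(1 / (2 * Real.pi)) ≠ 0 := neg_ne_zero.2 (by positivity)
  have e (η : ℝ) : expIntegral h η =
      FourierTransform.fourier (hhc.toSchwartzMap hh) (-(1 / (2 * Real.pi)) * η) := by
    rw [SchwartzMap.fourier_coe, Real.fourier_real_eq_integral_exp_smul]
    refine integral_congr_ae (Eventually.of_forall fun x => ?_)
    have : -2 * Real.pi * x * (-(1 / (2 * Real.pi)) * η) = η * x := by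
      field_simp
    simp only [this, smul_eq_mul]
    congr 2
    push_cast; ring
  have hi := ((FourierTransform.fourier (hhc.toSchwartzMap hh)).integrable_pow_mul volume 1
    |>.comp_mul_left' hc).const_mul (2 * Real.pi)
  have hint : Integrable h := hh.continuous.integrable_of_hasCompactSupport hhc
  refine hi.mono' (Complex.continuous_ofReal.mul
    (continuous_expIntegral hint)).aestronglyMeasurable (Eventually.of_forall fun η => ?_)
  simp only [← e, pow_one, norm_mul, Complex.norm_real, norm_neg]
  rw [Real.norm_of_nonneg (by positivity : 0 ≤ 1 / (2 * Real.pi))]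
  apply le_of_eq
  field_simp

lemma conj_expIntegral (f : ℝ → ℂ) (η : ℝ) :
    starRingEnd ℂ (expIntegral f η) =
      ∫ x : ℝ, Complex.exp (-(Complex.I * η * x)) * starRingEnd ℂ (f x) := by
  rw [expIntegral, ← integral_conj]
  simp [← Complex.exp_conj]

lemma integrable_conj_expIntegral_mul {f h : ℝ → ℂ} (hf : Integrable f)
    (hh : ContDiff ℝ (⊤ : ℕ∞) h) (hhc : HasCompactSupport h) :
    Integrable fun η : ℝ => (η : ℂ) * (starRingEnd ℂ (expIntegral f η) * expIntegral h η) := by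
  have := (integrable_mul_expIntegral hh hhc).bdd_mul
    (f := fun η => starRingEnd ℂ (expIntegral f η)) (c := ∫ x, ‖f x‖)
    (Complex.continuous_conj.comp (continuous_expIntegral hf)).aestronglyMeasurable
    (Eventually.of_forall fun η => by
      rw [RCLike.norm_conj]; exact norm_expIntegral_le f η)
  refine this.congr (Eventually.of_forall fun η => ?_)
  ring

/-- The regularised kernel integral as an exponentially damped Fourier integral. -/
lemma integral_kernel_eq {f h : ℝ → ℂ} (hf : Integrable f) (hh : Integrable h)
    {ε : ℝ} (hε : 0 < ε) :
    ∫ x : ℝ, ∫ y : ℝ, starRingEnd ℂ (f x) * h y *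
        ((x : ℂ) - (y : ℂ) - Complex.I * (ε : ℂ)) ^ (-2 : ℤ) =
      -∫ η in Set.Ioi (0 : ℝ), (Real.exp (-(ε * η)) : ℂ) *
        ((η : ℂ) * (starRingEnd ℂ (expIntegral f η) * expIntegral h η)) := by
  have hfc : Integrable fun x => starRingEnd ℂ (f x) :=
    (LinearIsometryEquiv.integrable_comp_iff Complex.conjLIE).2 hf
  have hdamp : Integrable (fun η : ℝ => (η : ℂ) * Complex.exp (-((ε : ℂ) * η)))
      (volume.restrict (Set.Ioi 0)) := by
    have := (integrableOn_rpow_mul_exp_neg_mul_rpow (p := 1) (s := 1) (by norm_num)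
      one_pos hε).ofReal (𝕜 := ℂ)
    simpa using this
  let G : ℝ → ℝ × ℝ → ℂ := fun η p =>
    ((η : ℂ) * Complex.exp (-((ε : ℂ) * η)) * (starRingEnd ℂ (f p.1) * h p.2)) *
      Complex.exp (Complex.I * η * ((p.2 - p.1 : ℝ) : ℂ))
  have hG : Integrable (Function.uncurry G)
      ((volume.restrict (Set.Ioi 0)).prod (volume.prod volume)) := by
    refine (hdamp.mul_prod (hfc.mul_prod hh)).mul_bdd
      (g := fun q : ℝ × ℝ × ℝ => Complex.exp (Complex.I * q.1 * ((q.2.2 - q.2.1 : ℝ) : ℂ)))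
      (c := 1) (Continuous.aestronglyMeasurable (by fun_prop))
      (Eventually.of_forall fun q => (norm_exp_I_mul_mul _ _).le)
  have hleft (η : ℝ) : ∫ p : ℝ × ℝ, G η p ∂(volume.prod volume) = (Real.exp (-(ε * η)) : ℂ) *
        ((η : ℂ) * (starRingEnd ℂ (expIntegral f η) * expIntegral h η)) := by
    rw [conj_expIntegral, expIntegral, ← integral_prod_mul, ← integral_const_mul,
      ← integral_const_mul]
    refine integral_congr_ae (Eventually.of_forall fun p => ?_)
    have : Complex.exp (Complex.I * η * ((p.2 - p.1 : ℝ) : ℂ)) =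
        Complex.exp (-(Complex.I * η * p.1)) * Complex.exp (Complex.I * η * p.2) := by
      rw [← Complex.exp_add]; congr 1; push_cast; ring
    simp only [G, this]
    push_cast
    ring
  have hright (p : ℝ × ℝ) : ∫ η in Set.Ioi (0 : ℝ), G η p =
      -(starRingEnd ℂ (f p.1) * h p.2 *
        ((p.1 : ℂ) - (p.2 : ℂ) - Complex.I * (ε : ℂ)) ^ (-2 : ℤ)) := by
    have hz : 0 < ((ε : ℂ) + Complex.I * ((p.1 : ℂ) - p.2)).re := by simpa using hε
    have hk : ((ε : ℂ) + Complex.I * ((p.1 : ℂ) - p.2)) ^ (-2 : ℤ) =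
        -((p.1 : ℂ) - (p.2 : ℂ) - Complex.I * (ε : ℂ)) ^ (-2 : ℤ) := by
      have : (ε : ℂ) + Complex.I * ((p.1 : ℂ) - p.2) =
          Complex.I * ((p.1 : ℂ) - (p.2 : ℂ) - Complex.I * (ε : ℂ)) := by
        linear_combination (ε : ℂ) * Complex.I_sq
      rw [this, mul_zpow]
      simp [zpow_neg, zpow_ofNat]
    rw [← mul_neg, ← hk, ← integral_mul_exp_neg_mul_Ioi hz, ← integral_const_mul]
    refine integral_congr_ae (Eventually.of_forall fun η => ?_)
    have : Complex.exp (-(((ε : ℂ) + Complex.I * ((p.1 : ℂ) - p.2)) * η)) =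
        Complex.exp (-((ε : ℂ) * η)) * Complex.exp (Complex.I * η * ((p.2 - p.1 : ℝ) : ℂ)) := by
      rw [← Complex.exp_add]; congr 1; push_cast; ring
    simp only [G, this]
    ring
  have hswap := integral_integral_swap hG
  have hK := hG.integral_prod_right
  simp only [Function.uncurry_apply_pair, hright] at hK
  simp only [hleft, hright] at hswap
  rw [hswap, integral_neg, neg_neg, integral_prod _ (by simpa using hK.neg)]

theorem stmt_13 (f h : ℝ → ℂ)
    (hf : ContDiff ℝ (⊤ : ℕ∞) f) (hfc : HasCompactSupport f)
    (hh : ContDiff ℝ (⊤ : ℕ∞) h) (hhc : HasCompactSupport h) :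
    let hat : (ℝ → ℂ) → ℝ → ℂ := fun g η =>
      (((2 * Real.pi) ^ (-(1 : ℝ) / 2) : ℝ) : ℂ) *
        ∫ x : ℝ, Complex.exp (Complex.I * η * x) * g x
    let L : ℂ := 2 * ∫ η in Set.Ioi (0 : ℝ),
      (η : ℂ) * starRingEnd ℂ (hat f η) * hat h η
    Tendsto (fun ε : ℝ => -(1 / (Real.pi : ℂ)) *
        ∫ x : ℝ, ∫ y : ℝ,
          starRingEnd ℂ (f x) * h y *
            ((x : ℂ) - (y : ℂ) - Complex.I * (ε : ℂ)) ^ (-2 : ℤ))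
      (nhdsWithin 0 (Set.Ioi 0)) (nhds L) ∧
    (f = h → L.im = 0 ∧ 0 ≤ L.re) := by
  intro hat L
  have hfi : Integrable f := hf.continuous.integrable_of_hasCompactSupport hfc
  have hhi : Integrable h := hh.continuous.integrable_of_hasCompactSupport hhc
  have hint := integrable_conj_expIntegral_mul hfi hh hhc
  have hc : ((2 * Real.pi) ^ (-(1 : ℝ) / 2) : ℝ) * ((2 * Real.pi) ^ (-(1 : ℝ) / 2) : ℝ) =
      1 / (2 * Real.pi) := by
    rw [← Real.rpow_add (by positivity), one_div, ← Real.rpow_neg_one]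
    norm_num
  have hL : L = (1 / (Real.pi : ℂ)) * ∫ η in Set.Ioi (0 : ℝ),
      (η : ℂ) * (starRingEnd ℂ (expIntegral f η) * expIntegral h η) := by
    simp only [L]
    rw [← integral_const_mul, ← integral_const_mul]
    refine integral_congr_ae (Eventually.of_forall fun η => ?_)
    have hc' := congrArg (fun r : ℝ => (r : ℂ)) hc
    have hpi : (Real.pi : ℂ) ≠ 0 := Complex.ofReal_ne_zero.2 Real.pi_ne_zero
    simp only [Complex.ofReal_mul, Complex.ofReal_div, Complex.ofReal_one,
      Complex.ofReal_ofNat] at hc'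
    have hp : 2 * (1 / (2 * (Real.pi : ℂ))) = 1 / (Real.pi : ℂ) := by field_simp
    simp only [hat, map_mul, Complex.conj_ofReal]
    change 2 * ((η : ℂ) * (_ * starRingEnd ℂ (expIntegral f η)) * (_ * expIntegral h η)) = _
    rw [← hp, ← hc']
    ring
  refine ⟨?_, ?_⟩
  · have hlim : Tendsto (fun ε : ℝ => ∫ η in Set.Ioi (0 : ℝ), (Real.exp (-(ε * η)) : ℂ) *
          ((η : ℂ) * (starRingEnd ℂ (expIntegral f η) * expIntegral h η)))
        (nhdsWithin 0 (Set.Ioi 0)) (nhds (∫ η in Set.Ioi (0 : ℝ),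
          (η : ℂ) * (starRingEnd ℂ (expIntegral f η) * expIntegral h η))) := by
      refine tendsto_integral_filter_of_dominated_convergence _ ?_ ?_
        hint.norm.restrict ?_
      · exact Eventually.of_forall fun ε => (Continuous.aestronglyMeasurable
          (by fun_prop)).mul hint.restrict.aestronglyMeasurable
      · filter_upwards [self_mem_nhdsWithin] with ε hε
        filter_upwards [ae_restrict_mem measurableSet_Ioi] with η hη
        rw [norm_mul, Complex.norm_real, Real.norm_of_nonneg (Real.exp_pos _).le]
        refine mul_le_of_le_one_left (norm_nonneg _) (Real.exp_le_one_iff.2 ?_)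
        exact neg_nonpos.2 (mul_pos hε hη).le
      · refine Eventually.of_forall fun η => ?_
        have hcont : Continuous fun ε : ℝ => (Real.exp (-(ε * η)) : ℂ) *
          ((η : ℂ) * (starRingEnd ℂ (expIntegral f η) * expIntegral h η)) := by fun_prop
        simpa using (hcont.tendsto 0).mono_left nhdsWithin_le_nhds
    rw [hL]
    refine (hlim.const_mul (1 / (Real.pi : ℂ))).congr' ?_
    filter_upwards [self_mem_nhdsWithin] with ε hε
    rw [integral_kernel_eq hfi hhi hε, neg_mul_neg]
  · rintro rfl
    have hre : L = ((1 / Real.pi * ∫ η in Set.Ioi (0 : ℝ), η * ‖expIntegral f η‖ ^ 2 : ℝ) : ℂ) := by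
      rw [hL]
      push_cast [← integral_complex_ofReal]
      simp only [Complex.conj_mul']
    rw [hre, Complex.ofReal_im, Complex.ofReal_re]
    refine ⟨rfl, mul_nonneg (by positivity) ?_⟩
    exact setIntegral_nonneg measurableSet_Ioi fun η hη => mul_nonneg (le_of_lt hη) (sq_nonneg _)
end
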